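/- Let 0 < s < 1/2 and let f be a smooth compactly supported function on ℝ^{2n+1}. Set u(p,ρ) = C₁(n,s) ρ^{2s} (f ∗ φ_{s,ρ})(p). Then for every p ∈ ℝ^{2n+1}: −lim_{ρ→0⁺} ρ^{1−2s} ∂_ρ u(p,ρ) = 2s · C₁(n,s) ∫_{ℝ^{2n+1}} (f(p) − f(q)) |q^{−1}·p|^{−(Q+2s)} dq. -/

import Mathlib

noncomputable section
open MeasureTheory Real Set Topology Filter
open scoped ENNReal NNReal

/-- The Heisenberg group `ℍⁿ = ℝⁿ × ℝⁿ × ℝ ≅ ℝ^{2n+1}`, points `p = (x, y, t)`. -/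
abbrev Heis (n : ℕ) := EuclideanSpace ℝ (Fin n) × EuclideanSpace ℝ (Fin n) × ℝ

namespace Heis

variable {n : ℕ}

/-- The Heisenberg group law
`(x,y,t)·(x',y',t') = (x+x', y+y', t+t' + (1/2)∑ (y_j x'_j − x_j y'_j))`. -/
def hmul (p q : Heis n) : Heis n :=
  (p.1 + q.1, p.2.1 + q.2.1,
    p.2.2 + q.2.2 + 1 / 2 * ∑ j, (p.2.1 j * q.1 j - p.1 j * q.2.1 j))

/-- The Heisenberg group inverse `p⁻¹ = (-x, -y, -t)`. -/
def hinv (p : Heis n) : Heis n := (-p.1, -p.2.1, -p.2.2)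

/-- Convolution on `ℍⁿ`: `(f ∗ g)(p) = ∫ f(p·q⁻¹) g(q) dq`. -/
def hconv (f g : Heis n → ℝ) (p : Heis n) : ℝ :=
  ∫ q : Heis n, f (hmul p (hinv q)) * g q

/-- The homogeneous norm `|(v,t)| = (|v|⁴ + 16 t²)^{1/4}`. -/
def hnorm (p : Heis n) : ℝ :=
  ((‖p.1‖ ^ 2 + ‖p.2.1‖ ^ 2) ^ 2 + 16 * p.2.2 ^ 2) ^ ((1 : ℝ) / 4)

/-- The kernel `φ_{s,ρ}(v,t) = ((ρ²+|v|²)² + 16t²)^{-(n+1+s)/2}`. -/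
def phiK (n : ℕ) (s ρ : ℝ) (p : Heis n) : ℝ :=
  ((ρ ^ 2 + (‖p.1‖ ^ 2 + ‖p.2.1‖ ^ 2)) ^ 2 + 16 * p.2.2 ^ 2) ^
    (-(((n : ℝ) + 1 + s) / 2))

/-- `C₁(n,s) = (4/π^{n+1/2})·Γ(n+s)Γ((n+1+s)/2)/(Γ(s)Γ((n+s)/2))`. -/
def C1 (n : ℕ) (s : ℝ) : ℝ :=
  4 / π ^ ((n : ℝ) + 1 / 2) *
    (Gamma ((n : ℝ) + s) * Gamma (((n : ℝ) + 1 + s) / 2)) /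
    (Gamma s * Gamma (((n : ℝ) + s) / 2))

/-- The left-invariant vector field `X_j = ∂_{x_j} + (1/2) y_j ∂_t`. -/
def vfX (j : Fin n) (F : Heis n → ℝ) (p : Heis n) : ℝ :=
  fderiv ℝ F p (EuclideanSpace.single j 1, 0, 0) +
    1 / 2 * p.2.1 j * fderiv ℝ F p (0, 0, 1)

/-- The left-invariant vector field `X_{n+j} = ∂_{y_j} − (1/2) x_j ∂_t`. -/
def vfY (j : Fin n) (F : Heis n → ℝ) (p : Heis n) : ℝ :=
  fderiv ℝ F p (0, EuclideanSpace.single j 1, 0) -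
    1 / 2 * p.1 j * fderiv ℝ F p (0, 0, 1)

/-- The vector field `∂_t`. -/
def vfT (F : Heis n → ℝ) (p : Heis n) : ℝ := fderiv ℝ F p (0, 0, 1)

/-- The sublaplacian `𝓛 = −∑_{j=1}^{2n} X_j²`. -/
def subL (F : Heis n → ℝ) (p : Heis n) : ℝ :=
  -(∑ j, (vfX j (vfX j F) p + vfY j (vfY j F) p))

/-- The extension operator
`𝕃u = −𝓛u + ∂_ρ²u + ((1−2s)/ρ)∂_ρu + (1/4)ρ²∂_t²u`, for `u = u(p, ρ)`. -/
def extOp (s : ℝ) (u : Heis n → ℝ → ℝ) (p : Heis n) (ρ : ℝ) : ℝ :=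
  -subL (fun q => u q ρ) p + deriv (deriv (u p)) ρ +
    (1 - 2 * s) / ρ * deriv (u p) ρ +
    1 / 4 * ρ ^ 2 * vfT (fun q => vfT (fun q' => u q' ρ) q) p

/-- `|∇u|² = ∑_{j=1}^{2n} (X_j u)² + (1/4)(∂_t u)² + (∂_ρ u)²` for `u = u(p, ρ)`. -/
def gradSq (u : Heis n → ℝ → ℝ) (p : Heis n) (ρ : ℝ) : ℝ :=
  (∑ j, ((vfX j (fun q => u q ρ) p) ^ 2 + (vfY j (fun q => u q ρ) p) ^ 2)) +
    1 / 4 * (vfT (fun q => u q ρ) p) ^ 2 + (deriv (u p) ρ) ^ 2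

end Heis

open Heis

namespace Heis
variable {n : ℕ}

theorem measurable_phiK (n : ℕ) (s ρ : ℝ) : Measurable (phiK n s ρ) := by
  unfold phiK; fun_prop

theorem measurable_phiK_uncurry (n : ℕ) (s : ℝ) :
    Measurable (fun z : Heis n × ℝ => phiK n s z.2 z.1) := by
  unfold phiK; fun_prop

theorem continuous_hmul_hinv (p : Heis n) : Continuous fun q => hmul p (hinv q) := by
  unfold hmul hinv; fun_prop

theorem measurePreserving_hmul_hinv_left (p : Heis n) :
    MeasurePreserving (fun q : Heis n => hmul (hinv q) p) := by
  have h1 : ∀ x : EuclideanSpace ℝ (Fin n), MeasurePreserving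
      (fun z : EuclideanSpace ℝ (Fin n) × ℝ => (-z.1 + p.2.1,
        -z.2 + p.2.2 + 1 / 2 * ∑ j, (-z.1 j * p.1 j - -x j * p.2.1 j))) := by
    intro x
    refine MeasurePreserving.skew_product (f := fun y => -y + p.2.1)
      (g := fun y t => -t + p.2.2 + 1 / 2 * ∑ j, (-y j * p.1 j - -x j * p.2.1 j)) ?_ ?_ ?_
    · exact (measurePreserving_add_right volume p.2.1).comp (Measure.measurePreserving_neg volume)
    · fun_prop
    · refine Eventually.of_forall fun y => ?_
      have := ((measurePreserving_add_right (volume : Measure ℝ)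
        (p.2.2 + 1 / 2 * ∑ j, (-y j * p.1 j - -x j * p.2.1 j))).comp
        (Measure.measurePreserving_neg volume)).map_eq
      simpa [Function.comp_def, add_assoc] using this
  refine MeasurePreserving.skew_product (f := fun x => -x + p.1)
      (g := fun x (z : EuclideanSpace ℝ (Fin n) × ℝ) => (-z.1 + p.2.1,
        -z.2 + p.2.2 + 1 / 2 * ∑ j, (-z.1 j * p.1 j - -x j * p.2.1 j))) ?_ ?_ ?_
  · exact (measurePreserving_add_right volume p.1).comp (Measure.measurePreserving_neg volume)
  · fun_prop
  · exact Eventually.of_forall fun x => (h1 x).map_eq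

theorem map_dilation (n : ℕ) {ρ : ℝ} (hρ : 0 < ρ) :
    Measure.map (fun q : Heis n => ((ρ • q.1, ρ • q.2.1, ρ ^ 2 • q.2.2) : Heis n)) volume =
      ENNReal.ofReal ((ρ ^ (2 * n + 2))⁻¹) • volume := by
  have e : (fun q : Heis n => ((ρ • q.1, ρ • q.2.1, ρ ^ 2 • q.2.2) : Heis n)) =
    Prod.map (ρ • ·) (Prod.map (ρ • ·) (ρ ^ 2 • ·)) := rfl
  rw [e, Measure.volume_eq_prod, ← Measure.map_prod_map _ _ (by fun_prop) (by fun_prop),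
    Measure.volume_eq_prod, ← Measure.map_prod_map _ _ (by fun_prop) (by fun_prop),
    Measure.map_addHaar_smul _ hρ.ne', Measure.map_addHaar_smul _ (pow_pos hρ 2).ne']
  simp only [Measure.prod_smul_left, Measure.prod_smul_right, smul_smul, finrank_euclideanSpace,
    Fintype.card_fin, Module.finrank_self]
  congr 1
  rw [← ENNReal.ofReal_mul (by positivity), ← ENNReal.ofReal_mul (by positivity)]
  congr 1
  rw [abs_of_pos (by positivity), abs_of_pos (by positivity)]
  field_simp
  ring

theorem phiK_dilation (n : ℕ) (s : ℝ) {ρ : ℝ} (hρ : 0 < ρ) (q : Heis n) :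
    phiK n s ρ (ρ • q.1, ρ • q.2.1, ρ ^ 2 • q.2.2) =
      ρ ^ (-(2 * n + 2 + 2 * s)) * phiK n s 1 q := by
  have e : (ρ ^ 2 + (‖ρ • q.1‖ ^ 2 + ‖ρ • q.2.1‖ ^ 2)) ^ 2 + 16 * (ρ ^ 2 • q.2.2) ^ 2 =
      ρ ^ (4 : ℝ) * ((1 ^ 2 + (‖q.1‖ ^ 2 + ‖q.2.1‖ ^ 2)) ^ 2 + 16 * q.2.2 ^ 2) := by
    rw [norm_smul, norm_smul, Real.norm_eq_abs, abs_of_pos hρ, smul_eq_mul,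
      show (4 : ℝ) = (4 : ℕ) by norm_num, rpow_natCast]
    ring
  rw [phiK, phiK]
  dsimp only
  rw [e, mul_rpow (by positivity) (by positivity), ← rpow_mul hρ.le]
  congr 2
  ring

theorem integrable_phiK_one (n : ℕ) {s : ℝ} (hs : 0 < s) : Integrable (phiK n s 1) := by
  have hE : Integrable (fun x : EuclideanSpace ℝ (Fin n) =>
      ((1 : ℝ) + ‖x‖ ^ 2) ^ (-(n + s / 2) / 2)) :=
    integrable_rpow_neg_one_add_norm_sq (by simp; positivity)
  have hR : Integrable (fun t : ℝ => ((1 : ℝ) + ‖t‖ ^ 2) ^ (-(1 + s / 2) / 2)) :=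
    integrable_rpow_neg_one_add_norm_sq (by simp; positivity)
  refine (hE.mul_prod (hE.mul_prod hR)).mono' (measurable_phiK n s 1).aestronglyMeasurable
    (Eventually.of_forall fun ⟨x, y, t⟩ => ?_)
  rw [Real.norm_eq_abs, Real.norm_eq_abs, sq_abs, phiK]
  dsimp only
  set B := (1 ^ 2 + (‖x‖ ^ 2 + ‖y‖ ^ 2)) ^ 2 + 16 * t ^ 2 with hB
  have hBpos : 0 < B := by positivity
  have key : ∀ X : ℝ, 1 ≤ X → X ^ 2 ≤ B →
      B ^ (-(n + s / 2) / 4) ≤ X ^ (-(n + s / 2) / 2) := by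
    intro X hX hXB
    have : X ^ (-(n + s / 2) / 2) = (X ^ 2) ^ (-(n + s / 2) / 4) := by
      rw [← rpow_natCast, ← rpow_mul (by linarith)]
      congr 1
      push_cast
      ring
    rw [this]
    exact rpow_le_rpow_of_nonpos (by positivity) hXB
      (by have : (0 : ℝ) ≤ n := n.cast_nonneg
          linarith)
  have hx := key (1 + ‖x‖ ^ 2) (by nlinarith [sq_nonneg ‖x‖])
    (by rw [hB]; nlinarith [sq_nonneg ‖x‖, sq_nonneg ‖y‖, sq_nonneg t,
          mul_nonneg (sq_nonneg ‖x‖) (sq_nonneg ‖y‖)])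
  have hy := key (1 + ‖y‖ ^ 2) (by nlinarith [sq_nonneg ‖y‖])
    (by rw [hB]; nlinarith [sq_nonneg ‖x‖, sq_nonneg ‖y‖, sq_nonneg t,
          mul_nonneg (sq_nonneg ‖x‖) (sq_nonneg ‖y‖)])
  have ht : B ^ (-(1 + s / 2) / 2) ≤ (1 + t ^ 2) ^ (-(1 + s / 2) / 2) :=
    rpow_le_rpow_of_nonpos (by positivity)
      (by rw [hB]; nlinarith [sq_nonneg ‖x‖, sq_nonneg ‖y‖, sq_nonneg t]) (by linarith)
  have e : B ^ (-(((n : ℝ) + 1 + s) / 2)) =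
      B ^ (-(n + s / 2) / 4) * (B ^ (-(n + s / 2) / 4) * B ^ (-(1 + s / 2) / 2)) := by
    rw [← rpow_add hBpos, ← rpow_add hBpos]
    congr 1
    ring
  rw [abs_of_pos (by positivity), e]
  gcongr

theorem integrable_phiK (n : ℕ) {s ρ : ℝ} (hs : 0 < s) (hρ : 0 < ρ) :
    Integrable (phiK n s ρ) := by
  have hc : ENNReal.ofReal ((ρ ^ (2 * n + 2))⁻¹) ≠ 0 := by
    rw [Ne, ENNReal.ofReal_eq_zero, not_le]
    positivity
  rw [← integrable_smul_measure hc ENNReal.ofReal_ne_top, ← map_dilation n hρ,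
    integrable_map_measure (measurable_phiK n s ρ).aestronglyMeasurable (by fun_prop)]
  refine ((integrable_phiK_one n hs).const_mul (ρ ^ (-(2 * n + 2 + 2 * s)))).congr
    (Eventually.of_forall fun q => ?_)
  exact (phiK_dilation n s hρ q).symm

theorem integral_phiK (n : ℕ) (s : ℝ) {ρ : ℝ} (hρ : 0 < ρ) :
    ∫ q : Heis n, phiK n s ρ q = ρ ^ (-(2 * s)) * ∫ q : Heis n, phiK n s 1 q := by
  have h := integral_map (μ := (volume : Measure (Heis n)))
    (φ := fun q : Heis n => ((ρ • q.1, ρ • q.2.1, ρ ^ 2 • q.2.2) : Heis n)) (by fun_prop)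
    (measurable_phiK n s ρ).aestronglyMeasurable
  rw [map_dilation n hρ, integral_smul_measure, ENNReal.toReal_ofReal (by positivity)] at h
  simp only [phiK_dilation n s hρ, integral_const_mul] at h
  rw [smul_eq_mul, inv_mul_eq_iff_eq_mul₀ (by positivity)] at h
  rw [h, ← mul_assoc, ← rpow_natCast, ← rpow_add hρ]
  congr 2
  push_cast
  ring

theorem hnorm_nonneg (q : Heis n) : 0 ≤ hnorm q := by
  unfold hnorm
  positivity

theorem hnorm_pow_four (q : Heis n) :
    hnorm q ^ 4 = (‖q.1‖ ^ 2 + ‖q.2.1‖ ^ 2) ^ 2 + 16 * q.2.2 ^ 2 := by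
  rw [hnorm, ← rpow_natCast, ← rpow_mul (by positivity)]
  norm_num

theorem phiK_nonneg (n : ℕ) (s ρ : ℝ) (q : Heis n) : 0 ≤ phiK n s ρ q := by
  unfold phiK
  positivity

theorem phiK_zero (s : ℝ) (q : Heis n) :
    phiK n s 0 q = hnorm q ^ (-(2 * (n : ℝ) + 2 + 2 * s)) := by
  rw [phiK, hnorm, ← rpow_mul (by positivity)]
  congr 1
  · ring
  · ring

theorem measurable_hnorm : Measurable (hnorm : Heis n → ℝ) := by
  unfold hnorm
  fun_prop

theorem hnorm_pow_four_le_phiK_base (ρ : ℝ) (q : Heis n) :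
    hnorm q ^ 4 ≤ (ρ ^ 2 + (‖q.1‖ ^ 2 + ‖q.2.1‖ ^ 2)) ^ 2 + 16 * q.2.2 ^ 2 := by
  rw [hnorm_pow_four]
  have h := pow_le_pow_left₀ (a := ‖q.1‖ ^ 2 + ‖q.2.1‖ ^ 2) (by positivity)
    (le_add_of_nonneg_left (sq_nonneg ρ)) 2
  linarith

theorem phiK_le_phiK_zero {s : ℝ} (hs : 0 < s) (ρ : ℝ) {q : Heis n} (hq : hnorm q ≠ 0) :
    phiK n s ρ q ≤ phiK n s 0 q := by
  have hq' : 0 < hnorm q := lt_of_le_of_ne (hnorm_nonneg q) hq.symm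
  have h4 : 0 < hnorm q ^ 4 := by positivity
  have := hnorm_pow_four q
  unfold phiK
  refine rpow_le_rpow_of_nonpos ?_ ?_ ?_
  · nlinarith
  · rw [zero_pow two_ne_zero, zero_add, ← this]
    exact hnorm_pow_four_le_phiK_base ρ q
  · have : (0 : ℝ) ≤ n := n.cast_nonneg
    linarith

theorem continuous_phiK_radius (s : ℝ) {q : Heis n} (hq : hnorm q ≠ 0) :
    Continuous fun ρ => phiK n s ρ q := by
  unfold phiK
  refine Continuous.rpow_const (by fun_prop) fun ρ => Or.inl ?_
  have hq' : 0 < hnorm q := lt_of_le_of_ne (hnorm_nonneg q) hq.symm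
  have h4 : 0 < hnorm q ^ 4 := by positivity
  exact (h4.trans_le (hnorm_pow_four_le_phiK_base ρ q)).ne'

theorem min_hnorm_mul_phiK_zero_le {s : ℝ} (hs : 0 < s) (q : Heis n) :
    min 1 (hnorm q) * phiK n s 0 q ≤
      (4 : ℝ) ^ (((n : ℝ) + 1 + s) / 2) * ∫ ρ in Ioc (0 : ℝ) 1, phiK n s ρ q := by
  have hI : 0 ≤ ∫ ρ in Ioc (0 : ℝ) 1, phiK n s ρ q :=
    integral_nonneg fun ρ => phiK_nonneg n s ρ q
  by_cases hq : hnorm q = 0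
  · rw [hq, min_eq_right zero_le_one, zero_mul]
    exact mul_nonneg (by positivity) hI
  have hq' : 0 < hnorm q := lt_of_le_of_ne (hnorm_nonneg q) (Ne.symm hq)
  set m := min 1 (hnorm q)
  have hm : 0 < m := lt_min one_pos hq'
  have hle : ∀ ρ ∈ Ioc 0 m,
      (4 : ℝ) ^ (-(((n : ℝ) + 1 + s) / 2)) * phiK n s 0 q ≤ phiK n s ρ q := by
    intro ρ hρ
    have h1 : ρ ^ 4 ≤ hnorm q ^ 4 :=
      pow_le_pow_left₀ hρ.1.le (hρ.2.trans (min_le_right _ _)) 4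
    have h2 := hnorm_pow_four q
    have h4 : 0 < hnorm q ^ 4 := by positivity
    have h3 := hnorm_pow_four_le_phiK_base ρ q
    unfold phiK
    rw [← mul_rpow (by norm_num) (by positivity)]
    refine rpow_le_rpow_of_nonpos (by linarith) ?_
      (by have : (0 : ℝ) ≤ n := n.cast_nonneg
          linarith)
    rw [zero_pow two_ne_zero, zero_add]
    nlinarith [sq_nonneg (ρ ^ 2 - (‖q.1‖ ^ 2 + ‖q.2.1‖ ^ 2)), sq_nonneg q.2.2]
  have hint : IntegrableOn (fun ρ => phiK n s ρ q) (Ioc (0 : ℝ) 1) :=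
    (continuous_phiK_radius s hq).integrableOn_Ioc
  have hsub : Ioc 0 m ⊆ Ioc (0 : ℝ) 1 := Ioc_subset_Ioc_right (min_le_left _ _)
  have h5 : m * ((4 : ℝ) ^ (-(((n : ℝ) + 1 + s) / 2)) * phiK n s 0 q) ≤
      ∫ ρ in Ioc (0 : ℝ) 1, phiK n s ρ q := by
    calc _ = ∫ ρ in Ioc 0 m, (4 : ℝ) ^ (-(((n : ℝ) + 1 + s) / 2)) * phiK n s 0 q := by
          simp [hm.le]
      _ ≤ ∫ ρ in Ioc 0 m, phiK n s ρ q :=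
          setIntegral_mono_on continuous_const.integrableOn_Ioc (hint.mono_set hsub) measurableSet_Ioc hle
      _ ≤ _ := setIntegral_mono_set hint
          (Eventually.of_forall fun ρ => phiK_nonneg n s ρ q) hsub.eventuallyLE
  calc m * phiK n s 0 q = (4 : ℝ) ^ (((n : ℝ) + 1 + s) / 2) *
        (m * ((4 : ℝ) ^ (-(((n : ℝ) + 1 + s) / 2)) * phiK n s 0 q)) := by
        rw [rpow_neg (by norm_num)]
        field_simp
    _ ≤ _ := by gcongr

theorem integrable_min_hnorm_mul_phiK_zero (n : ℕ) {s : ℝ} (hs0 : 0 < s) (hs1 : s < 1 / 2) :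
    Integrable fun q : Heis n => min 1 (hnorm q) * phiK n s 0 q := by
  have hprod : Integrable (fun z : Heis n × ℝ => phiK n s z.2 z.1)
      (volume.prod (volume.restrict (Ioc (0 : ℝ) 1))) := by
    rw [integrable_prod_iff' (measurable_phiK_uncurry n s).aestronglyMeasurable]
    constructor
    · exact (ae_restrict_mem measurableSet_Ioc).mono fun ρ hρ => integrable_phiK n hs0 hρ.1
    · have hpow : IntegrableOn (fun ρ : ℝ => ρ ^ (-(2 * s)) * ∫ q : Heis n, phiK n s 1 q)
          (Ioc 0 1) := by
        refine Integrable.mul_const ?_ _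
        exact (intervalIntegrable_iff_integrableOn_Ioc_of_le zero_le_one).1
          (intervalIntegral.intervalIntegrable_rpow' (by linarith))
      refine hpow.congr_fun (fun ρ hρ => ?_) measurableSet_Ioc
      dsimp only
      rw [← integral_phiK n s hρ.1]
      exact integral_congr_ae (Eventually.of_forall fun q =>
        (Real.norm_of_nonneg (phiK_nonneg n s ρ q)).symm)
  refine (hprod.integral_prod_left.const_mul ((4 : ℝ) ^ (((n : ℝ) + 1 + s) / 2))).mono'
    ((measurable_const.min measurable_hnorm).mul (measurable_phiK n s 0)).aestronglyMeasurable
    (Eventually.of_forall fun q => ?_)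
  rw [Real.norm_of_nonneg
    (mul_nonneg (le_min zero_le_one (hnorm_nonneg q)) (phiK_nonneg n s 0 q))]
  exact min_hnorm_mul_phiK_zero_le hs0 q

theorem dist_hmul_hinv_le (p q : Heis n) (hq : hnorm q ≤ 1) :
    dist (hmul p (hinv q)) p ≤ (1 + ‖p.1‖ + ‖p.2.1‖) * hnorm q := by
  obtain ⟨a, b, c⟩ := p
  obtain ⟨x, y, t⟩ := q
  set N := hnorm (x, y, t)
  have hN : 0 ≤ N := hnorm_nonneg _
  have h4 : N ^ 4 = (‖x‖ ^ 2 + ‖y‖ ^ 2) ^ 2 + 16 * t ^ 2 := hnorm_pow_four _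
  have hx : ‖x‖ ≤ N := by
    refine le_of_pow_le_pow_left₀ (n := 4) (by norm_num) hN ?_
    rw [h4]
    nlinarith [sq_nonneg ‖x‖, sq_nonneg ‖y‖, sq_nonneg t,
      mul_nonneg (sq_nonneg ‖x‖) (sq_nonneg ‖y‖)]
  have hy : ‖y‖ ≤ N := by
    refine le_of_pow_le_pow_left₀ (n := 4) (by norm_num) hN ?_
    rw [h4]
    nlinarith [sq_nonneg ‖x‖, sq_nonneg ‖y‖, sq_nonneg t,
      mul_nonneg (sq_nonneg ‖x‖) (sq_nonneg ‖y‖)]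
  have ht : |t| ≤ N := by
    have h1 : |t| ≤ N ^ 2 := by
      refine abs_le_of_sq_le_sq ?_ (by positivity)
      nlinarith [sq_nonneg t, sq_nonneg (‖x‖ ^ 2 + ‖y‖ ^ 2)]
    nlinarith
  have hinner : ∑ j, (b j * (-x) j - a j * (-y) j) = inner ℝ a y - inner ℝ b x := by
    simp only [PiLp.inner_apply, RCLike.inner_apply, conj_trivial, ← Finset.sum_sub_distrib,
      PiLp.neg_apply]
    exact Finset.sum_congr rfl fun j _ => by ring
  have hay : |inner ℝ a y| ≤ ‖a‖ * N :=
    (abs_real_inner_le_norm a y).trans (by gcongr)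
  have hbx : |inner ℝ b x| ≤ ‖b‖ * N :=
    (abs_real_inner_le_norm b x).trans (by gcongr)
  have hab : N ≤ (1 + ‖a‖ + ‖b‖) * N := by
    nlinarith [mul_nonneg (norm_nonneg a) hN, mul_nonneg (norm_nonneg b) hN]
  simp only [hmul, hinv, Prod.dist_eq, hinner]
  refine max_le ?_ (max_le ?_ ?_)
  · simpa [dist_eq_norm] using hx.trans hab
  · simpa [dist_eq_norm] using hy.trans hab
  · rw [Real.dist_eq]
    rw [abs_le] at *
    constructor <;> nlinarith [mul_nonneg (norm_nonneg a) hN, mul_nonneg (norm_nonneg b) hN]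

/-- The derivative of `ρ ↦ φ_{s,ρ}(q)`. -/
def phiKDeriv (n : ℕ) (s ρ : ℝ) (q : Heis n) : ℝ :=
  4 * ρ * (ρ ^ 2 + (‖q.1‖ ^ 2 + ‖q.2.1‖ ^ 2)) * (-(((n : ℝ) + 1 + s) / 2)) *
    ((ρ ^ 2 + (‖q.1‖ ^ 2 + ‖q.2.1‖ ^ 2)) ^ 2 + 16 * q.2.2 ^ 2) ^
      (-(((n : ℝ) + 1 + s) / 2) - 1)

theorem measurable_phiKDeriv (n : ℕ) (s ρ : ℝ) : Measurable (phiKDeriv n s ρ) := by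
  unfold phiKDeriv
  fun_prop

theorem hasDerivAt_phiK (s : ℝ) {ρ : ℝ} (hρ : 0 < ρ) (q : Heis n) :
    HasDerivAt (fun r => phiK n s r q) (phiKDeriv n s ρ q) ρ := by
  have h1 : HasDerivAt
      (fun r : ℝ => (r ^ 2 + (‖q.1‖ ^ 2 + ‖q.2.1‖ ^ 2)) ^ 2 + 16 * q.2.2 ^ 2)
      (4 * ρ * (ρ ^ 2 + (‖q.1‖ ^ 2 + ‖q.2.1‖ ^ 2))) ρ := by
    have := ((((hasDerivAt_id ρ).pow 2).add_const (‖q.1‖ ^ 2 + ‖q.2.1‖ ^ 2)).pow 2).add_const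
      (16 * q.2.2 ^ 2)
    refine this.congr_deriv ?_
    simp
    ring
  exact h1.rpow_const (Or.inl (by positivity))

theorem abs_mul_phiKDeriv_le {s : ℝ} (hs : 0 < s) {ρ : ℝ} (hρ : 0 < ρ) (q : Heis n) :
    |ρ * phiKDeriv n s ρ q| ≤ 2 * ((n : ℝ) + 1 + s) * phiK n s ρ q := by
  unfold phiKDeriv phiK
  set w := ‖q.1‖ ^ 2 + ‖q.2.1‖ ^ 2 with hw
  have hw0 : 0 ≤ w := by positivity
  set B := (ρ ^ 2 + w) ^ 2 + 16 * q.2.2 ^ 2 with hB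
  have hBpos : 0 < B := by positivity
  have hn : (0 : ℝ) ≤ n := n.cast_nonneg
  rw [rpow_sub_one hBpos.ne']
  set P := B ^ (-(((n : ℝ) + 1 + s) / 2))
  have hP : 0 ≤ P := by positivity
  have hle : ρ ^ 2 * (ρ ^ 2 + w) / B ≤ 1 := by
    rw [div_le_one hBpos]
    nlinarith [sq_nonneg q.2.2, sq_nonneg ρ]
  have h0 : 0 ≤ ρ ^ 2 * (ρ ^ 2 + w) / B := by positivity
  have e : ρ * (4 * ρ * (ρ ^ 2 + w) * (-(((n : ℝ) + 1 + s) / 2)) * (P / B)) =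
      -(2 * ((n : ℝ) + 1 + s) * P * (ρ ^ 2 * (ρ ^ 2 + w) / B)) := by
    field_simp
    ring
  rw [e, abs_neg, abs_of_nonneg (by positivity)]
  exact mul_le_of_le_one_right (by positivity) hle

theorem tendsto_mul_phiKDeriv (s : ℝ) {q : Heis n} (hq : hnorm q ≠ 0) :
    Tendsto (fun ρ => ρ * phiKDeriv n s ρ q) (𝓝 0) (𝓝 0) := by
  have h4 : 0 < hnorm q ^ 4 := pow_pos (lt_of_le_of_ne (hnorm_nonneg q) hq.symm) 4
  have hc : Continuous fun ρ => ρ * phiKDeriv n s ρ q := by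
    unfold phiKDeriv
    refine continuous_id.mul (Continuous.mul (by fun_prop) ?_)
    exact Continuous.rpow_const (by fun_prop) fun ρ => Or.inl
      (h4.trans_le (hnorm_pow_four_le_phiK_base ρ q)).ne'
  simpa using hc.tendsto 0

section

variable {s : ℝ} {g : Heis n → ℝ} {C : ℝ}

theorem integrable_mul_phiK_zero (hs0 : 0 < s) (hs1 : s < 1 / 2) (hg : Measurable g)
    (hgC : ∀ q, |g q| ≤ C * min 1 (hnorm q)) : Integrable fun q => g q * phiK n s 0 q := by
  refine ((integrable_min_hnorm_mul_phiK_zero n hs0 hs1).const_mul C).mono'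
    (hg.mul (measurable_phiK n s 0)).aestronglyMeasurable (Eventually.of_forall fun q => ?_)
  rw [norm_mul, Real.norm_of_nonneg (phiK_nonneg n s 0 q), ← mul_assoc]
  exact mul_le_mul_of_nonneg_right (hgC q) (phiK_nonneg n s 0 q)

theorem eq_zero_of_hnorm_eq_zero (hgC : ∀ q, |g q| ≤ C * min 1 (hnorm q)) {q : Heis n}
    (hq : hnorm q = 0) : g q = 0 := by
  have := hgC q
  rw [hq, min_eq_right zero_le_one, mul_zero] at this
  exact abs_nonpos_iff.1 this

theorem abs_mul_phiK_le (hs0 : 0 < s) (hgC : ∀ q, |g q| ≤ C * min 1 (hnorm q)) (ρ : ℝ)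
    (q : Heis n) : |g q * phiK n s ρ q| ≤ |g q * phiK n s 0 q| := by
  by_cases hq : hnorm q = 0
  · simp [eq_zero_of_hnorm_eq_zero hgC hq]
  · rw [abs_mul, abs_mul, abs_of_nonneg (phiK_nonneg n s ρ q),
      abs_of_nonneg (phiK_nonneg n s 0 q)]
    exact mul_le_mul_of_nonneg_left (phiK_le_phiK_zero hs0 ρ hq) (abs_nonneg _)

theorem integrable_mul_phiK (hs0 : 0 < s) (hs1 : s < 1 / 2) (hg : Measurable g)
    (hgC : ∀ q, |g q| ≤ C * min 1 (hnorm q)) (ρ : ℝ) :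
    Integrable fun q => g q * phiK n s ρ q :=
  (integrable_mul_phiK_zero hs0 hs1 hg hgC).mono
    (hg.mul (measurable_phiK n s ρ)).aestronglyMeasurable
    (Eventually.of_forall fun q => abs_mul_phiK_le hs0 hgC ρ q)

theorem abs_mul_mul_phiKDeriv_le (hs0 : 0 < s) (hgC : ∀ q, |g q| ≤ C * min 1 (hnorm q))
    {ρ : ℝ} (hρ : 0 < ρ) (q : Heis n) :
    |g q * (ρ * phiKDeriv n s ρ q)| ≤ 2 * ((n : ℝ) + 1 + s) * |g q * phiK n s 0 q| := by
  calc |g q * (ρ * phiKDeriv n s ρ q)|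
      ≤ |g q| * (2 * ((n : ℝ) + 1 + s) * phiK n s ρ q) := by
        rw [abs_mul]
        exact mul_le_mul_of_nonneg_left (abs_mul_phiKDeriv_le hs0 hρ q) (abs_nonneg _)
    _ = 2 * ((n : ℝ) + 1 + s) * |g q * phiK n s ρ q| := by
        rw [abs_mul, abs_of_nonneg (phiK_nonneg n s ρ q)]
        ring
    _ ≤ _ := mul_le_mul_of_nonneg_left (abs_mul_phiK_le hs0 hgC ρ q) (by positivity)

theorem hasDerivAt_integral_mul_phiK (hs0 : 0 < s) (hs1 : s < 1 / 2) (hg : Measurable g)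
    (hgC : ∀ q, |g q| ≤ C * min 1 (hnorm q)) {ρ : ℝ} (hρ : 0 < ρ) :
    HasDerivAt (fun r => ∫ q, g q * phiK n s r q) (∫ q, g q * phiKDeriv n s ρ q) ρ := by
  refine (hasDerivAt_integral_of_dominated_loc_of_deriv_le (s := Ioi (ρ / 2))
    (F := fun r q => g q * phiK n s r q) (F' := fun r q => g q * phiKDeriv n s r q)
    (bound := fun q => 2 / ρ * (2 * ((n : ℝ) + 1 + s) * |g q * phiK n s 0 q|))
    (Ioi_mem_nhds (by linarith))
    (Eventually.of_forall fun r => (hg.mul (measurable_phiK n s r)).aestronglyMeasurable)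
    (integrable_mul_phiK hs0 hs1 hg hgC ρ)
    (hg.mul (measurable_phiKDeriv n s ρ)).aestronglyMeasurable
    (Eventually.of_forall fun q r hr => ?_)
    (((integrable_mul_phiK_zero hs0 hs1 hg hgC).abs.const_mul _).const_mul _)
    (Eventually.of_forall fun q r hr => ?_)).2
  · have hr' : ρ / 2 < r := hr
    have hr0 : 0 < r := by linarith
    have h := abs_mul_mul_phiKDeriv_le hs0 hgC hr0 q
    have e : g q * phiKDeriv n s r q = r⁻¹ * (g q * (r * phiKDeriv n s r q)) := by
      field_simp
    rw [e, Real.norm_eq_abs, abs_mul, abs_of_pos (inv_pos.2 hr0)]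
    refine mul_le_mul ?_ h (abs_nonneg _) (by positivity)
    rw [inv_eq_one_div, div_le_div_iff₀ hr0 hρ]
    linarith
  · have hr' : ρ / 2 < r := hr
    exact (hasDerivAt_phiK s (by linarith) q).const_mul (g q)

theorem tendsto_integral_mul_phiK (hs0 : 0 < s) (hs1 : s < 1 / 2) (hg : Measurable g)
    (hgC : ∀ q, |g q| ≤ C * min 1 (hnorm q)) :
    Tendsto (fun r => ∫ q, g q * phiK n s r q) (𝓝[>] 0) (𝓝 (∫ q, g q * phiK n s 0 q)) := by
  refine tendsto_integral_filter_of_dominated_convergence (fun q => |g q * phiK n s 0 q|)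
    (Eventually.of_forall fun r => (hg.mul (measurable_phiK n s r)).aestronglyMeasurable)
    (Eventually.of_forall fun r => Eventually.of_forall fun q => abs_mul_phiK_le hs0 hgC r q)
    (integrable_mul_phiK_zero hs0 hs1 hg hgC).abs (Eventually.of_forall fun q => ?_)
  by_cases hq : hnorm q = 0
  · simp [eq_zero_of_hnorm_eq_zero hgC hq]
  · exact (((continuous_phiK_radius s hq).tendsto 0).mono_left nhdsWithin_le_nhds).const_mul _

theorem tendsto_mul_integral_mul_phiKDeriv (hs0 : 0 < s) (hs1 : s < 1 / 2) (hg : Measurable g)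
    (hgC : ∀ q, |g q| ≤ C * min 1 (hnorm q)) :
    Tendsto (fun r => r * ∫ q, g q * phiKDeriv n s r q) (𝓝[>] 0) (𝓝 0) := by
  have h : Tendsto (fun r => ∫ q, g q * (r * phiKDeriv n s r q)) (𝓝[>] 0)
      (𝓝 (∫ _ : Heis n, (0 : ℝ))) := by
    refine tendsto_integral_filter_of_dominated_convergence
      (fun q => 2 * ((n : ℝ) + 1 + s) * |g q * phiK n s 0 q|)
      (Eventually.of_forall fun r =>
        (hg.mul ((measurable_phiKDeriv n s r).const_mul r)).aestronglyMeasurable)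
      (eventually_mem_nhdsWithin.mono fun r hr => Eventually.of_forall fun q =>
        abs_mul_mul_phiKDeriv_le hs0 hgC hr q)
      ((integrable_mul_phiK_zero hs0 hs1 hg hgC).abs.const_mul _)
      (Eventually.of_forall fun q => ?_)
    by_cases hq : hnorm q = 0
    · simp [eq_zero_of_hnorm_eq_zero hgC hq]
    · simpa using ((tendsto_mul_phiKDeriv s hq).mono_left nhdsWithin_le_nhds).const_mul (g q)
  rw [integral_zero] at h
  refine h.congr fun r => ?_
  rw [← integral_const_mul]
  exact integral_congr_ae (Eventually.of_forall fun q => by ring)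

end

theorem exists_abs_sub_le_min_hnorm {f : Heis n → ℝ} (hf : ContDiff ℝ (⊤ : ℕ∞) f)
    (hfc : HasCompactSupport f) (p : Heis n) :
    ∃ C, ∀ q, |f (hmul p (hinv q)) - f p| ≤ C * min 1 (hnorm q) := by
  obtain ⟨K, hK⟩ := hf.lipschitzWith_of_hasCompactSupport hfc (by simp)
  obtain ⟨M, hM⟩ := hfc.exists_bound_of_continuous hf.continuous
  have hM0 : 0 ≤ M := (norm_nonneg _).trans (hM p)
  refine ⟨K * (1 + ‖p.1‖ + ‖p.2.1‖) + 2 * M, fun q => ?_⟩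
  have hq := hnorm_nonneg q
  rcases le_total (hnorm q) 1 with h | h
  · rw [min_eq_right h]
    calc |f (hmul p (hinv q)) - f p| ≤ K * dist (hmul p (hinv q)) p := hK.dist_le_mul _ _
      _ ≤ K * ((1 + ‖p.1‖ + ‖p.2.1‖) * hnorm q) := by
          gcongr
          exact dist_hmul_hinv_le p q h
      _ ≤ _ := by nlinarith [mul_nonneg hM0 hq]
  · rw [min_eq_left h, mul_one]
    calc |f (hmul p (hinv q)) - f p| ≤ |f (hmul p (hinv q))| + |f p| := abs_sub _ _
      _ ≤ 2 * M := by
          have h1 := hM (hmul p (hinv q))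
          have h2 := hM p
          rw [Real.norm_eq_abs] at h1 h2
          linarith
      _ ≤ _ := le_add_of_nonneg_left (by positivity)

theorem hmul_hinv_hmul_hinv (p q : Heis n) : hmul p (hinv (hmul (hinv q) p)) = q := by
  obtain ⟨a, b, c⟩ := p
  obtain ⟨x, y, t⟩ := q
  simp only [hmul, hinv, Prod.mk.injEq]
  refine ⟨by abel, by abel, ?_⟩
  have : ∑ j, (b j * (-(-x + a)) j - a j * (-(-y + b)) j) =
      -∑ j, (-(-y j * a j - -x j * b j)) := by
    rw [← Finset.sum_neg_distrib]
    refine Finset.sum_congr rfl fun j _ => ?_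
    simp only [PiLp.neg_apply, PiLp.add_apply]
    ring
  rw [this, Finset.sum_neg_distrib]
  simp only [PiLp.neg_apply]
  ring

theorem integral_sub_mul_hnorm_rpow {f : Heis n → ℝ} (hf : Continuous f) (s : ℝ) (p : Heis n) :
    ∫ q : Heis n, (f p - f q) * hnorm (hmul (hinv q) p) ^ (-(2 * (n : ℝ) + 2 + 2 * s)) =
      -∫ q : Heis n, (f (hmul p (hinv q)) - f p) * phiK n s 0 q := by
  have hT := measurePreserving_hmul_hinv_left p
  have hm : Measurable fun q : Heis n => (f (hmul p (hinv q)) - f p) * phiK n s 0 q :=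
    (((hf.comp (continuous_hmul_hinv p)).measurable).sub_const _).mul (measurable_phiK n s 0)
  have h := integral_map (μ := (volume : Measure (Heis n))) hT.measurable.aemeasurable
    hm.aestronglyMeasurable
  rw [hT.map_eq] at h
  rw [h, ← integral_neg]
  refine integral_congr_ae (Eventually.of_forall fun q => ?_)
  dsimp only
  rw [hmul_hinv_hmul_hinv, phiK_zero]
  ring

theorem hconv_phiK {f : Heis n → ℝ} {s ρ : ℝ} (hs0 : 0 < s) (hρ : 0 < ρ) (p : Heis n)
    (hint : Integrable fun q => (f (hmul p (hinv q)) - f p) * phiK n s ρ q) :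
    hconv f (phiK n s ρ) p = (∫ q, (f (hmul p (hinv q)) - f p) * phiK n s ρ q) +
      f p * (ρ ^ (-(2 * s)) * ∫ q : Heis n, phiK n s 1 q) := by
  rw [← integral_phiK n s hρ, ← integral_const_mul,
    ← integral_add hint ((integrable_phiK n hs0 hρ).const_mul _), hconv]
  exact integral_congr_ae (Eventually.of_forall fun q => by ring)

end Heis

theorem stmt_11 (n : ℕ) (hn : 1 ≤ n) (s : ℝ) (hs0 : 0 < s) (hs1 : s < 1 / 2)
    (f : Heis n → ℝ) (hf : ContDiff ℝ (⊤ : ℕ∞) f) (hfc : HasCompactSupport f)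
    (p : Heis n) :
    Tendsto
      (fun ρ : ℝ =>
        ρ ^ (1 - 2 * s) *
          deriv (fun r : ℝ => C1 n s * r ^ (2 * s) * hconv f (phiK n s r) p) ρ)
      (𝓝[>] 0)
      (𝓝 (-(2 * s * C1 n s * ∫ q : Heis n,
        (f p - f q) * hnorm (hmul (hinv q) p) ^ (-(2 * (n : ℝ) + 2 + 2 * s))))) := by
  obtain ⟨C, hgC⟩ := exists_abs_sub_le_min_hnorm hf hfc p
  have hg : Measurable fun q : Heis n => f (hmul p (hinv q)) - f p :=
    ((hf.continuous.comp (continuous_hmul_hinv p)).measurable).sub_const _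
  have hlim := (((tendsto_integral_mul_phiK hs0 hs1 hg hgC).const_mul (2 * s)).add
    (tendsto_mul_integral_mul_phiKDeriv hs0 hs1 hg hgC)).const_mul (C1 n s)
  rw [integral_sub_mul_hnorm_rpow hf.continuous,
    show ∀ I : ℝ, -(2 * s * C1 n s * -I) = C1 n s * (2 * s * I + 0) from fun I => by ring]
  refine hlim.congr' (eventually_mem_nhdsWithin.mono fun ρ hρ => ?_)
  have hρ0 : 0 < ρ := hρ
  have hder : HasDerivAt (fun r : ℝ => C1 n s * (r ^ (2 * s) *
      (∫ q, (f (hmul p (hinv q)) - f p) * phiK n s r q) + f p * ∫ q : Heis n, phiK n s 1 q))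
      (C1 n s * (2 * s * ρ ^ (2 * s - 1) *
        (∫ q, (f (hmul p (hinv q)) - f p) * phiK n s ρ q) +
        ρ ^ (2 * s) * ∫ q, (f (hmul p (hinv q)) - f p) * phiKDeriv n s ρ q)) ρ :=
    (((hasDerivAt_rpow_const (Or.inl hρ0.ne')).mul
      (hasDerivAt_integral_mul_phiK hs0 hs1 hg hgC hρ0)).add_const _).const_mul _
  have heq : (fun r : ℝ => C1 n s * r ^ (2 * s) * hconv f (phiK n s r) p) =ᶠ[𝓝 ρ]
      fun r : ℝ => C1 n s * (r ^ (2 * s) *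
        (∫ q, (f (hmul p (hinv q)) - f p) * phiK n s r q) +
        f p * ∫ q : Heis n, phiK n s 1 q) := by
    filter_upwards [Ioi_mem_nhds hρ0] with r hr
    have hr0 : 0 < r := hr
    rw [hconv_phiK hs0 hr0 p (integrable_mul_phiK hs0 hs1 hg hgC r), rpow_neg hr0.le]
    have : r ^ (2 * s) ≠ 0 := (rpow_pos_of_pos hr0 _).ne'
    field_simp
  dsimp only
  rw [heq.deriv_eq, hder.deriv]
  have e1 : ρ ^ (1 - 2 * s) * ρ ^ (2 * s - 1) = 1 := by
    rw [← rpow_add hρ0, show 1 - 2 * s + (2 * s - 1) = 0 by ring, rpow_zero]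
  have e2 : ρ ^ (1 - 2 * s) * ρ ^ (2 * s) = ρ := by
    rw [← rpow_add hρ0, show 1 - 2 * s + 2 * s = 1 by ring, rpow_one]
  linear_combination (-(C1 n s * (2 * s) * ∫ q, (f (hmul p (hinv q)) - f p) * phiK n s ρ q)) * e1
    - (C1 n s * ∫ q, (f (hmul p (hinv q)) - f p) * phiKDeriv n s ρ q) * e2
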